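/- Let k be a field, Λ and Γ finite dimensional k-algebras, M a finitely generated (Λ,Γ)-bimodule that is projective as a right Γ-module, and N a finitely generated (Γ,Λ)-bimodule that is projective as a right Λ-module. Then the syzygy Ω_{Λ^e}(M ⊗_Γ N) is stably isomorphic, as a Λ^e-module, to Ω_{Λ⊗_kΓ^op}(M) ⊗_Γ N. -/

import Mathlib

open TensorProduct MulOpposite

section BimodInfra

variable (k : Type) [Field k]

/-- The `k`-algebra endomorphism ring homomorphism sending a `k`-linear endomorphism `f` of `Y`
to `X ⊗ f`. -/
noncomputable def lTensorAlgHom (X Y : Type) [AddCommGroup X] [Module k X] [AddCommGroup Y] [Module k Y] :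
    Module.End k Y →ₐ[k] Module.End k (X ⊗[k] Y) where
  toFun f := LinearMap.lTensor X f
  map_one' := LinearMap.lTensor_id X Y
  map_mul' f g := LinearMap.lTensor_comp X f g
  map_zero' := LinearMap.lTensor_zero X
  map_add' f g := LinearMap.lTensor_add X f g
  commutes' c := by
    ext y
    simp [Module.algebraMap_end_apply, TensorProduct.smul_tmul', TensorProduct.tmul_smul]

/-- Same for `f ⊗ Y`. -/
noncomputable def rTensorAlgHom (X Y : Type) [AddCommGroup X] [Module k X] [AddCommGroup Y] [Module k Y] :
    Module.End k X →ₐ[k] Module.End k (X ⊗[k] Y) where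
  toFun f := LinearMap.rTensor Y f
  map_one' := LinearMap.rTensor_id Y X
  map_mul' f g := LinearMap.rTensor_comp Y f g
  map_zero' := LinearMap.rTensor_zero Y
  map_add' f g := LinearMap.rTensor_add Y f g
  commutes' c := by
    ext x
    simp [Module.algebraMap_end_apply, TensorProduct.smul_tmul', TensorProduct.tmul_smul]

variable (A B C : Type) [Ring A] [Ring B] [Ring C] [Algebra k A] [Algebra k B] [Algebra k C]
variable (X : Type) [AddCommGroup X] [Module k X] [Module (A ⊗[k] Bᵐᵒᵖ) X]
  [IsScalarTower k (A ⊗[k] Bᵐᵒᵖ) X]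
variable (Y : Type) [AddCommGroup Y] [Module k Y] [Module (B ⊗[k] Cᵐᵒᵖ) Y]
  [IsScalarTower k (B ⊗[k] Cᵐᵒᵖ) Y]

/-- The action of `A ⊗ Cᵐᵒᵖ` on `X ⊗[k] Y`: `A` acts through the left tensor factor of `X`,
`Cᵐᵒᵖ` acts through the right tensor factor of `Y`. -/
noncomputable def outerAction : (A ⊗[k] Cᵐᵒᵖ) →ₐ[k] Module.End k (X ⊗[k] Y) :=
  Algebra.TensorProduct.lift
    ((rTensorAlgHom k X Y).comp ((Algebra.lsmul k k X).comp
      (Algebra.TensorProduct.includeLeft : A →ₐ[k] A ⊗[k] Bᵐᵒᵖ)))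
    ((lTensorAlgHom k X Y).comp ((Algebra.lsmul k k Y).comp
      (Algebra.TensorProduct.includeRight : Cᵐᵒᵖ →ₐ[k] B ⊗[k] Cᵐᵒᵖ)))
    (fun a c => by
      show Commute (LinearMap.rTensor Y _) (LinearMap.lTensor X _)
      unfold Commute SemiconjBy
      ext x y
      simp [LinearMap.rTensor, LinearMap.lTensor, TensorProduct.map_tmul])

/-- The `(A ⊗ Cᵐᵒᵖ)`-module structure on `X ⊗[k] Y`. -/
noncomputable def outerModule : Module (A ⊗[k] Cᵐᵒᵖ) (X ⊗[k] Y) :=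
  Module.compHom _ (outerAction k A B C X Y).toRingHom

/-- The submodule of `X ⊗[k] Y` generated by the `B`-balancing relations
`(x·b) ⊗ y - x ⊗ (b·y)`. -/
noncomputable def balancedSub : @Submodule (A ⊗[k] Cᵐᵒᵖ) (X ⊗[k] Y) _ _
    (outerModule k A B C X Y) :=
  letI := outerModule k A B C X Y
  Submodule.span (A ⊗[k] Cᵐᵒᵖ)
    {z | ∃ (x : X) (b : B) (y : Y),
      z = ((((1 : A) ⊗ₜ[k] (op b)) • x) ⊗ₜ[k] y) - (x ⊗ₜ[k] ((b ⊗ₜ[k] (1 : Cᵐᵒᵖ)) • y))}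

/-- The balanced tensor product `X ⊗_B Y` of the `(A,B)`-bimodule `X` and the
`(B,C)`-bimodule `Y`, an `(A,C)`-bimodule, i.e. a left `A ⊗[k] Cᵐᵒᵖ`-module. -/
noncomputable def BTensor : Type :=
  letI := outerModule k A B C X Y
  (X ⊗[k] Y) ⧸ balancedSub k A B C X Y

noncomputable instance BTensor.instAddCommGroup : AddCommGroup (BTensor k A B C X Y) :=
  letI := outerModule k A B C X Y
  inferInstanceAs (AddCommGroup ((X ⊗[k] Y) ⧸ balancedSub k A B C X Y))

noncomputable instance BTensor.instModule : Module (A ⊗[k] Cᵐᵒᵖ) (BTensor k A B C X Y) :=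
  letI := outerModule k A B C X Y
  inferInstanceAs (Module (A ⊗[k] Cᵐᵒᵖ) ((X ⊗[k] Y) ⧸ balancedSub k A B C X Y))

noncomputable instance BTensor.instModuleK : Module k (BTensor k A B C X Y) :=
  Module.compHom _ (algebraMap k (A ⊗[k] Cᵐᵒᵖ))

noncomputable instance BTensor.instTower :
    IsScalarTower k (A ⊗[k] Cᵐᵒᵖ) (BTensor k A B C X Y) :=
  ⟨fun c s z => by
    have h : (c • s) = algebraMap k (A ⊗[k] Cᵐᵒᵖ) c * s := Algebra.smul_def c s
    rw [h, mul_smul]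
    rfl⟩

end BimodInfra

section Restrict

variable (k : Type) [Field k] (A B : Type) [Ring A] [Ring B] [Algebra k A] [Algebra k B]
variable (X : Type) [AddCommGroup X] [Module (A ⊗[k] Bᵐᵒᵖ) X]

/-- The left `A`-module structure on an `(A,B)`-bimodule. -/
noncomputable def leftRestrict : Module A X :=
  Module.compHom X (Algebra.TensorProduct.includeLeft : A →ₐ[k] A ⊗[k] Bᵐᵒᵖ).toRingHom

/-- The right `B`-module (left `Bᵐᵒᵖ`-module) structure on an `(A,B)`-bimodule. -/
noncomputable def rightRestrict : Module Bᵐᵒᵖ X :=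
  Module.compHom X (Algebra.TensorProduct.includeRight : Bᵐᵒᵖ →ₐ[k] A ⊗[k] Bᵐᵒᵖ).toRingHom

/-- The canonical `k`-module structure on a module over the `k`-algebra `S`. -/
def modK (S : Type) [Ring S] [Algebra k S] (Z : Type) [AddCommGroup Z] [Module S Z] :
    Module k Z :=
  Module.compHom Z (algebraMap k S)

/-- The compatibility of `modK` with the `S`-action. -/
def towerK (S : Type) [Ring S] [Algebra k S] (Z : Type) [AddCommGroup Z] [Module S Z] :
    letI := modK k S Z; IsScalarTower k S Z := by
  letI := modK k S Z
  exact ⟨fun c s z => by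
    have h : (c • s) = algebraMap k S c * s := Algebra.smul_def c s
    rw [h, mul_smul]
    rfl⟩

end Restrict

section Regular

variable (k : Type) [Field k] (A : Type) [Ring A] [Algebra k A]

/-- The regular `(A,A)`-bimodule structure on `A`: `(a ⊗ bᵒᵖ) • x = a * x * b`. -/
noncomputable def regularBimodule : Module (A ⊗[k] Aᵐᵒᵖ) A :=
  TensorProduct.Algebra.module

end Regular

/-- `p : P → M` is a projective cover: `P` is finitely generated projective, `p` is
surjective and `ker p` is superfluous in `P`. -/
def IsProjCover (S : Type) [Ring S] {P M : Type} [AddCommGroup P] [Module S P]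
    [AddCommGroup M] [Module S M] (p : P →ₗ[S] M) : Prop :=
  Module.Finite S P ∧ Module.Projective S P ∧ Function.Surjective p ∧
    ∀ L : Submodule S P, L ⊔ LinearMap.ker p = ⊤ → L = ⊤

/-- `Z` is a syzygy of `M`: the kernel of a projective cover of `M`. -/
def IsSyzygyOf (S : Type) [Ring S] (Z M : ModuleCat.{0} S) : Prop :=
  ∃ (P : ModuleCat.{0} S) (p : P →ₗ[S] M),
    IsProjCover S p ∧ Nonempty (Z ≃ₗ[S] LinearMap.ker p)

/-- `Z` is an `n`-th syzygy of `M` (with respect to projective covers). -/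
def IsNthSyzygyOf (S : Type) [Ring S] : ℕ → ModuleCat.{0} S → ModuleCat.{0} S → Prop
  | 0, Z, M => Nonempty (Z ≃ₗ[S] M)
  | n + 1, Z, M => ∃ W : ModuleCat.{0} S, IsNthSyzygyOf S n W M ∧ IsSyzygyOf S Z W

/-- `X` is periodic of period `p`: `Ω^p(X) ≅ X` and `p` is the least positive
integer with this property. -/
def IsPeriodicWithPeriod (S : Type) [Ring S] (X : ModuleCat.{0} S) (p : ℕ) : Prop :=
  0 < p ∧ (∃ Z, IsNthSyzygyOf S p Z X ∧ Nonempty (Z ≃ₗ[S] X)) ∧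
    ∀ q : ℕ, 0 < q → (∃ Z, IsNthSyzygyOf S q Z X ∧ Nonempty (Z ≃ₗ[S] X)) → p ≤ q

/-- `A` and `B` are stably isomorphic: `A ⊕ P ≅ B ⊕ Q` for some finitely generated
projective modules `P` and `Q`. -/
def StablyIso (S : Type) [Ring S] (A B : Type) [AddCommGroup A] [Module S A]
    [AddCommGroup B] [Module S B] : Prop :=
  ∃ P Q : ModuleCat.{0} S,
    Module.Finite S P ∧ Module.Projective S P ∧
    Module.Finite S Q ∧ Module.Projective S Q ∧
    Nonempty ((A × P) ≃ₗ[S] (B × Q))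

section SingEq

variable (k : Type) [Field k]
variable (Λ Γ : Type) [Ring Λ] [Ring Γ] [Algebra k Λ] [Algebra k Γ]
variable (M : Type) [AddCommGroup M] [Module k M] [Module (Λ ⊗[k] Γᵐᵒᵖ) M]
  [IsScalarTower k (Λ ⊗[k] Γᵐᵒᵖ) M]
variable (N : Type) [AddCommGroup N] [Module k N] [Module (Γ ⊗[k] Λᵐᵒᵖ) N]
  [IsScalarTower k (Γ ⊗[k] Λᵐᵒᵖ) N]

/-- The pair of bimodules `(M, N)` defines a singular equivalence of Morita type with
level `l`:  `M`, `N` are finitely generated projective on either side, `M ⊗_Γ N` is stably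
isomorphic to `Ω_{Λᵉ}^l(Λ)` and `N ⊗_Λ M` is stably isomorphic to `Ω_{Γᵉ}^l(Γ)`. -/
noncomputable def DefinesSingEqOfLevel (l : ℕ) : Prop :=
  (letI := leftRestrict k Λ Γ M; Module.Finite Λ M ∧ Module.Projective Λ M) ∧
  (letI := rightRestrict k Λ Γ M; Module.Finite Γᵐᵒᵖ M ∧ Module.Projective Γᵐᵒᵖ M) ∧
  (letI := leftRestrict k Γ Λ N; Module.Finite Γ N ∧ Module.Projective Γ N) ∧
  (letI := rightRestrict k Γ Λ N; Module.Finite Λᵐᵒᵖ N ∧ Module.Projective Λᵐᵒᵖ N) ∧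
  (letI := regularBimodule k Λ;
    ∃ Z : ModuleCat.{0} (Λ ⊗[k] Λᵐᵒᵖ),
      IsNthSyzygyOf (Λ ⊗[k] Λᵐᵒᵖ) l Z (ModuleCat.of (Λ ⊗[k] Λᵐᵒᵖ) Λ) ∧
      StablyIso (Λ ⊗[k] Λᵐᵒᵖ) (BTensor k Λ Γ Λ M N) Z) ∧
  (letI := regularBimodule k Γ;
    ∃ Z : ModuleCat.{0} (Γ ⊗[k] Γᵐᵒᵖ),
      IsNthSyzygyOf (Γ ⊗[k] Γᵐᵒᵖ) l Z (ModuleCat.of (Γ ⊗[k] Γᵐᵒᵖ) Γ) ∧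
      StablyIso (Γ ⊗[k] Γᵐᵒᵖ) (BTensor k Γ Λ Γ N M) Z)

end SingEq

/-- A witness that `Λ` and `Γ` are singularly equivalent of Morita type with level. -/
structure SingEqMoritaLevel (k Λ Γ : Type) [Field k] [Ring Λ] [Ring Γ]
    [Algebra k Λ] [Algebra k Γ] : Type 1 where
  M : Type
  N : Type
  [acgM : AddCommGroup M] [modkM : Module k M] [modM : Module (Λ ⊗[k] Γᵐᵒᵖ) M]
  [towM : IsScalarTower k (Λ ⊗[k] Γᵐᵒᵖ) M]
  [acgN : AddCommGroup N] [modkN : Module k N] [modN : Module (Γ ⊗[k] Λᵐᵒᵖ) N]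
  [towN : IsScalarTower k (Γ ⊗[k] Λᵐᵒᵖ) N]
  l : ℕ
  defines : DefinesSingEqOfLevel k Λ Γ M N l

/-- `M` is an eventually periodic module: some syzygy `Ω^n(M)` is nonzero and periodic. -/
def IsEventuallyPeriodicModule (S : Type) [Ring S] (M : ModuleCat.{0} S) : Prop :=
  ∃ (n : ℕ) (Z : ModuleCat.{0} S), IsNthSyzygyOf S n Z M ∧ Nontrivial Z ∧
    ∃ p : ℕ, 0 < p ∧ ∃ W, IsNthSyzygyOf S p W Z ∧ Nonempty (W ≃ₗ[S] Z)

/-- `Λ` is an eventually periodic algebra: it is eventually periodic as a module over its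
enveloping algebra `Λ ⊗[k] Λᵐᵒᵖ`. -/
noncomputable def IsEventuallyPeriodicAlgebra (k Λ : Type) [Field k] [Ring Λ]
    [Algebra k Λ] : Prop :=
  letI := regularBimodule k Λ
  IsEventuallyPeriodicModule (Λ ⊗[k] Λᵐᵒᵖ) (ModuleCat.of (Λ ⊗[k] Λᵐᵒᵖ) Λ)

namespace BTensor

variable (k : Type) [Field k]
variable (A B C : Type) [Ring A] [Ring B] [Ring C] [Algebra k A] [Algebra k B] [Algebra k C]
variable (X : Type) [AddCommGroup X] [Module k X] [Module (A ⊗[k] Bᵐᵒᵖ) X]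
  [IsScalarTower k (A ⊗[k] Bᵐᵒᵖ) X]
variable (X' : Type) [AddCommGroup X'] [Module k X'] [Module (A ⊗[k] Bᵐᵒᵖ) X']
  [IsScalarTower k (A ⊗[k] Bᵐᵒᵖ) X']
variable (Y : Type) [AddCommGroup Y] [Module k Y] [Module (B ⊗[k] Cᵐᵒᵖ) Y]
  [IsScalarTower k (B ⊗[k] Cᵐᵒᵖ) Y]

/-- The canonical projection from the tensor product over `k` to the one over `B`. -/
noncomputable def mk : X ⊗[k] Y →+ BTensor k A B C X Y :=
  letI := outerModule k A B C X Y
  (balancedSub k A B C X Y).mkQ.toAddMonoidHom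

theorem mk_surjective : Function.Surjective (mk k A B C X Y) :=
  letI := outerModule k A B C X Y
  (balancedSub k A B C X Y).mkQ_surjective

theorem outerAction_tmul (a : A) (c : Cᵐᵒᵖ) (x : X) (y : Y) :
    outerAction k A B C X Y (a ⊗ₜ c) (x ⊗ₜ y) =
      ((a ⊗ₜ[k] (1 : Bᵐᵒᵖ)) • x) ⊗ₜ[k] (((1 : B) ⊗ₜ[k] c) • y) := by
  simp [outerAction, lTensorAlgHom, rTensorAlgHom]

theorem mk_outerAction (s : A ⊗[k] Cᵐᵒᵖ) (t : X ⊗[k] Y) :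
    mk k A B C X Y (outerAction k A B C X Y s t) = s • mk k A B C X Y t :=
  rfl

theorem mk_smul_tmul_smul (a : A) (c : Cᵐᵒᵖ) (x : X) (y : Y) :
    mk k A B C X Y (((a ⊗ₜ[k] (1 : Bᵐᵒᵖ)) • x) ⊗ₜ[k] (((1 : B) ⊗ₜ[k] c) • y)) =
      (a ⊗ₜ[k] c) • mk k A B C X Y (x ⊗ₜ y) := by
  rw [← outerAction_tmul, mk_outerAction]

theorem mk_balanced (b : B) (x : X) (y : Y) :
    mk k A B C X Y ((((1 : A) ⊗ₜ[k] (op b)) • x) ⊗ₜ[k] y) =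
      mk k A B C X Y (x ⊗ₜ[k] ((b ⊗ₜ[k] (1 : Cᵐᵒᵖ)) • y)) := by
  let := outerModule k A B C X Y
  rw [← sub_eq_zero, ← map_sub]
  exact (Submodule.Quotient.mk_eq_zero _).2 (Submodule.subset_span ⟨x, b, y, rfl⟩)

/-- The balancing relations already generate `balancedSub` as an additive group. -/
theorem mem_closure_of_mem_balancedSub {z : X ⊗[k] Y} (hz : z ∈ balancedSub k A B C X Y) :
    z ∈ AddSubgroup.closure {z : X ⊗[k] Y | ∃ (x : X) (b : B) (y : Y),
      z = ((((1 : A) ⊗ₜ[k] (op b)) • x) ⊗ₜ[k] y) -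
        (x ⊗ₜ[k] ((b ⊗ₜ[k] (1 : Cᵐᵒᵖ)) • y))} := by
  let := outerModule k A B C X Y
  induction hz using Submodule.span_induction with
  | mem z hz => exact AddSubgroup.subset_closure hz
  | zero => exact zero_mem _
  | add _ _ _ _ h₁ h₂ => exact add_mem h₁ h₂
  | smul s z _ h =>
    change outerAction k A B C X Y s z ∈ _
    induction s using TensorProduct.induction_on with
    | zero => simp
    | add s₁ s₂ h₁ h₂ => rw [map_add]; exact add_mem h₁ h₂
    | tmul a c =>
      clear * - h
      induction h using AddSubgroup.closure_induction with
      | zero => simp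
      | add _ _ _ _ h₁ h₂ => rw [map_add]; exact add_mem h₁ h₂
      | neg _ _ h => rw [map_neg]; exact neg_mem h
      | mem z hz =>
        obtain ⟨x, b, y, rfl⟩ := hz
        refine AddSubgroup.subset_closure
          ⟨(a ⊗ₜ[k] (1 : Bᵐᵒᵖ)) • x, b, ((1 : B) ⊗ₜ[k] c) • y, ?_⟩
        rw [map_sub, outerAction_tmul, outerAction_tmul]
        simp only [smul_smul, Algebra.TensorProduct.tmul_mul_tmul, one_mul, mul_one]

variable {A B C X X' Y}

/-- The additive map out of `X ⊗_B Y` induced by a balanced map. -/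
noncomputable def liftAdd {Z : Type} [AddCommGroup Z] (φ : X ⊗[k] Y →+ Z)
    (hφ : ∀ (x : X) (b : B) (y : Y), φ ((((1 : A) ⊗ₜ[k] (op b)) • x) ⊗ₜ[k] y) =
      φ (x ⊗ₜ[k] ((b ⊗ₜ[k] (1 : Cᵐᵒᵖ)) • y))) : BTensor k A B C X Y →+ Z :=
  letI := outerModule k A B C X Y
  QuotientAddGroup.lift (balancedSub k A B C X Y).toAddSubgroup φ fun z hz => by
    refine (AddSubgroup.closure_le φ.ker).2 ?_ (mem_closure_of_mem_balancedSub k A B C X Y hz)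
    rintro _ ⟨x, b, y, rfl⟩
    simp [hφ]

@[simp]
theorem liftAdd_mk {Z : Type} [AddCommGroup Z] (φ : X ⊗[k] Y →+ Z)
    (hφ : ∀ (x : X) (b : B) (y : Y), φ ((((1 : A) ⊗ₜ[k] (op b)) • x) ⊗ₜ[k] y) =
      φ (x ⊗ₜ[k] ((b ⊗ₜ[k] (1 : Cᵐᵒᵖ)) • y))) (t : X ⊗[k] Y) :
    liftAdd k φ hφ (mk k A B C X Y t) = φ t :=
  rfl

/-- Additive maps out of `X ⊗_B Y` which agree on pure tensors are equal. -/
theorem addHom_ext {Z : Type} [AddCommGroup Z] {f g : BTensor k A B C X Y →+ Z}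
    (h : ∀ x y, f (mk k A B C X Y (x ⊗ₜ y)) = g (mk k A B C X Y (x ⊗ₜ y))) : f = g := by
  ext z
  obtain ⟨t, rfl⟩ := mk_surjective k A B C X Y z
  induction t using TensorProduct.induction_on with
  | zero => simp
  | tmul x y => exact h x y
  | add _ _ h₁ h₂ => simp only [map_add, h₁, h₂]

/-- An additive map out of `X ⊗_B Y` compatible with the actions of `A` and `C` on pure tensors
is linear. -/
noncomputable def toLinear {Z : Type} [AddCommGroup Z] [Module (A ⊗[k] Cᵐᵒᵖ) Z]
    (f : BTensor k A B C X Y →+ Z)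
    (hf : ∀ (a : A) (c : Cᵐᵒᵖ) (x : X) (y : Y),
      f (mk k A B C X Y (((a ⊗ₜ[k] (1 : Bᵐᵒᵖ)) • x) ⊗ₜ[k] (((1 : B) ⊗ₜ[k] c) • y))) =
        (a ⊗ₜ[k] c) • f (mk k A B C X Y (x ⊗ₜ y))) :
    BTensor k A B C X Y →ₗ[A ⊗[k] Cᵐᵒᵖ] Z where
  __ := f
  map_smul' s z := by
    change f (s • z) = s • f z
    induction s using TensorProduct.induction_on with
    | zero =>
      exact ((congrArg f (zero_smul (A ⊗[k] Cᵐᵒᵖ) z)).trans f.map_zero).trans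
        (zero_smul (A ⊗[k] Cᵐᵒᵖ) (f z)).symm
    | add _ _ h₁ h₂ => simp only [add_smul, map_add, h₁, h₂]
    | tmul a c =>
      refine DFunLike.congr_fun (addHom_ext k (f := f.comp (DistribSMul.toAddMonoidHom _ (a ⊗ₜ[k] c)))
        (g := (DistribSMul.toAddMonoidHom _ (a ⊗ₜ[k] c)).comp f) fun x y => ?_) z
      simp [← mk_smul_tmul_smul, hf]

@[simp]
theorem toLinear_apply {Z : Type} [AddCommGroup Z] [Module (A ⊗[k] Cᵐᵒᵖ) Z]
    (f : BTensor k A B C X Y →+ Z)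
    (hf : ∀ (a : A) (c : Cᵐᵒᵖ) (x : X) (y : Y),
      f (mk k A B C X Y (((a ⊗ₜ[k] (1 : Bᵐᵒᵖ)) • x) ⊗ₜ[k] (((1 : B) ⊗ₜ[k] c) • y))) =
        (a ⊗ₜ[k] c) • f (mk k A B C X Y (x ⊗ₜ y))) (z : BTensor k A B C X Y) :
    toLinear k f hf z = f z :=
  rfl

variable (C Y) in
/-- The additive map `X ⊗_B Y → X' ⊗_B Y` induced by a map of right `B`-modules. -/
noncomputable def mapAdd (f : X →ₗ[k] X')
    (hf : ∀ (b : B) (x : X), f (((1 : A) ⊗ₜ[k] op b) • x) = ((1 : A) ⊗ₜ[k] op b) • f x) :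
    BTensor k A B C X Y →+ BTensor k A B C X' Y :=
  liftAdd k ((mk k A B C X' Y).comp (f.rTensor Y).toAddMonoidHom) fun x b y => by
    simp [hf, mk_balanced]

@[simp]
theorem mapAdd_mk_tmul (f : X →ₗ[k] X')
    (hf : ∀ (b : B) (x : X), f (((1 : A) ⊗ₜ[k] op b) • x) = ((1 : A) ⊗ₜ[k] op b) • f x)
    (x : X) (y : Y) :
    mapAdd k C Y f hf (mk k A B C X Y (x ⊗ₜ y)) = mk k A B C X' Y (f x ⊗ₜ y) :=
  rfl

variable (C Y) in
/-- The bimodule map `X ⊗_B Y → X' ⊗_B Y` induced by a bimodule map `X → X'`. -/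
noncomputable def map (f : X →ₗ[A ⊗[k] Bᵐᵒᵖ] X') :
    BTensor k A B C X Y →ₗ[A ⊗[k] Cᵐᵒᵖ] BTensor k A B C X' Y :=
  toLinear k (mapAdd k C Y (f.restrictScalars k) fun _ x => f.map_smul _ x) fun a c x y =>
    (congrArg (fun x' => mk k A B C X' Y (x' ⊗ₜ _)) (f.map_smul _ x)).trans
      (mk_smul_tmul_smul k A B C X' Y a c (f x) y)

@[simp]
theorem map_mk_tmul (f : X →ₗ[A ⊗[k] Bᵐᵒᵖ] X') (x : X) (y : Y) :
    map k C Y f (mk k A B C X Y (x ⊗ₜ y)) = mk k A B C X' Y (f x ⊗ₜ y) :=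
  rfl


variable (A B C) in
/-- The coordinate of `(A ⊗ Bᵒᵖ) ⊗_B Y` associated with a coordinate `g` of the right
`C`-module `Y`, sending `(a ⊗ b) ⊗ y` to `a ⊗ g (b y)`. -/
noncomputable def freeCoord (g : Y →ₗ[k] Cᵐᵒᵖ)
    (hg : ∀ (c : Cᵐᵒᵖ) (y : Y), g (((1 : B) ⊗ₜ[k] c) • y) = c * g y) :
    BTensor k A B C (A ⊗[k] Bᵐᵒᵖ) Y →ₗ[A ⊗[k] Cᵐᵒᵖ] A ⊗[k] Cᵐᵒᵖ :=
  toLinear k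
    (liftAdd k
      ((TensorProduct.lift (LinearMap.mk₂ k
          (fun (b : Bᵐᵒᵖ) (y : Y) => g ((unop b ⊗ₜ[k] (1 : Cᵐᵒᵖ)) • y))
          (by simp [add_tmul, add_smul]) (by simp [← smul_tmul'])
          (by simp) (fun c b y => by rw [smul_comm, map_smul]))).lTensor A ∘ₗ
        (TensorProduct.assoc k A Bᵐᵒᵖ Y).toLinearMap).toAddMonoidHom
      fun x b y => by
        induction x using TensorProduct.induction_on with
        | zero => simp
        | add _ _ h₁ h₂ => simp only [smul_add, add_tmul, map_add, h₁, h₂]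
        | tmul a b' => simp [smul_smul])
    fun a c x y => by
      induction x using TensorProduct.induction_on with
      | zero => simp
      | add _ _ h₁ h₂ => simp only [smul_add, add_tmul, map_add, h₁, h₂]
      | tmul a' b' =>
        have h : (unop b' ⊗ₜ[k] (1 : Cᵐᵒᵖ)) • ((1 : B) ⊗ₜ[k] c) • y =
            ((1 : B) ⊗ₜ[k] c) • (unop b' ⊗ₜ[k] (1 : Cᵐᵒᵖ)) • y := by
          simp [smul_smul]
        simp [h, hg]

@[simp]
theorem freeCoord_mk_tmul (g : Y →ₗ[k] Cᵐᵒᵖ)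
    (hg : ∀ (c : Cᵐᵒᵖ) (y : Y), g (((1 : B) ⊗ₜ[k] c) • y) = c * g y)
    (a : A) (b : Bᵐᵒᵖ) (y : Y) :
    freeCoord k A B C g hg (mk k A B C _ Y ((a ⊗ₜ b) ⊗ₜ y)) =
      a ⊗ₜ g ((unop b ⊗ₜ[k] (1 : Cᵐᵒᵖ)) • y) :=
  rfl

theorem sum_freeCoord_smul {ι : Type} [Fintype ι] (g : ι → Y →ₗ[k] Cᵐᵒᵖ)
    (hg : ∀ i (c : Cᵐᵒᵖ) (y : Y), g i (((1 : B) ⊗ₜ[k] c) • y) = c * g i y) (v : ι → Y)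
    (hv : ∀ y, ∑ i, ((1 : B) ⊗ₜ[k] g i y) • v i = y) (s : A ⊗[k] Bᵐᵒᵖ) (x : X) (y : Y) :
    ∑ i, freeCoord k A B C (g i) (hg i) (mk k A B C _ Y (s ⊗ₜ y)) •
      mk k A B C X Y (x ⊗ₜ v i) = mk k A B C X Y ((s • x) ⊗ₜ y) := by
  induction s using TensorProduct.induction_on with
  | zero =>
    have h : (0 : A ⊗[k] Bᵐᵒᵖ) • x = 0 := zero_smul (A ⊗[k] Bᵐᵒᵖ) x
    rw [h, zero_tmul, zero_tmul, map_zero, map_zero]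
    exact Finset.sum_eq_zero fun i _ => by rw [map_zero]; exact zero_smul (A ⊗[k] Cᵐᵒᵖ) (mk k A B C X Y _)
  | add _ _ h₁ h₂ =>
    simp only [add_smul, add_tmul, map_add, Finset.sum_add_distrib, h₁, h₂]
  | tmul a b =>
    simp only [freeCoord_mk_tmul, ← mk_smul_tmul_smul]
    rw [← map_sum, ← tmul_sum, hv, ← mk_balanced]
    simp [smul_smul]

end BTensor

theorem exists_dual_basis (R V : Type) [Ring R] [AddCommGroup V] [Module R V] [Module.Finite R V]
    [Module.Projective R V] : ∃ (n : ℕ) (u : Fin n → V →ₗ[R] R) (v : Fin n → V),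
      ∀ x, ∑ i, u i x • v i = x := by
  obtain ⟨n, f, hf⟩ := Module.Finite.exists_fin' R V
  obtain ⟨s, hs⟩ := Module.projective_lifting_property f LinearMap.id hf
  refine ⟨n, fun i => LinearMap.proj i ∘ₗ s, fun i => f (Pi.single i 1), fun x => ?_⟩
  have h : s x = ∑ i, s x i • Pi.single (M := fun _ => R) i (1 : R) := pi_eq_sum_univ' (s x)
  calc _ = f (∑ i, s x i • Pi.single (M := fun _ => R) i (1 : R)) := by simp
    _ = x := by rw [← h]; exact LinearMap.congr_fun hs x

theorem finite_and_projective_of_dual_basis {R V ι : Type} [Ring R] [AddCommGroup V] [Module R V]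
    [Fintype ι] (u : ι → V →ₗ[R] R) (v : ι → V) (h : ∀ x, ∑ i, u i x • v i = x) :
    Module.Finite R V ∧ Module.Projective R V := by
  have hs : Fintype.linearCombination R v ∘ₗ LinearMap.pi u = LinearMap.id := by
    ext x
    simp [Fintype.linearCombination_apply, h]
  exact ⟨Module.Finite.of_surjective (Fintype.linearCombination R v)
    fun x => ⟨_, LinearMap.congr_fun hs x⟩, Module.Projective.of_split _ _ hs⟩

/-- Schanuel's lemma. -/
theorem nonempty_ker_prod_equiv_ker_prod {R P Q V : Type} [Ring R] [AddCommGroup P] [Module R P]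
    [AddCommGroup Q] [Module R Q] [AddCommGroup V] [Module R V] [Module.Projective R P]
    [Module.Projective R Q] (p : P →ₗ[R] V) (q : Q →ₗ[R] V) (hp : Function.Surjective p)
    (hq : Function.Surjective q) :
    Nonempty ((LinearMap.ker p × Q) ≃ₗ[R] (LinearMap.ker q × P)) := by
  obtain ⟨f, hf⟩ := Module.projective_lifting_property q p hq
  obtain ⟨g, hg⟩ := Module.projective_lifting_property p q hp
  replace hf x : q (f x) = p x := LinearMap.congr_fun hf x
  replace hg x : p (g x) = q x := LinearMap.congr_fun hg x
  exact ⟨{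
    toFun x := (⟨x.2 - f (x.1 + g x.2), by
      have := x.1.2
      simp_all⟩, x.1 + g x.2)
    invFun x := (⟨x.2 - g (x.1 + f x.2), by
      have := x.1.2
      simp_all⟩, x.1 + f x.2)
    map_add' x y := by
      ext <;> simp <;> abel
    map_smul' c x := by
      ext <;> simp [smul_sub]
    left_inv x := by
      ext <;> simp
    right_inv x := by
      ext <;> simp }⟩

theorem isScalarTower_rightRestrict (k A B X : Type) [Field k] [Ring A] [Ring B] [Algebra k A]
    [Algebra k B] [AddCommGroup X] [Module k X] [Module (A ⊗[k] Bᵐᵒᵖ) X]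
    [IsScalarTower k (A ⊗[k] Bᵐᵒᵖ) X] :
    letI := rightRestrict k A B X
    IsScalarTower k Bᵐᵒᵖ X :=
  letI := rightRestrict k A B X
  ⟨fun c b x => by
    change ((1 : A) ⊗ₜ[k] (c • b)) • x = c • ((1 : A) ⊗ₜ[k] b) • x
    rw [tmul_smul, smul_assoc]⟩

namespace BTensor

variable {k A B C : Type} [Field k] [Ring A] [Ring B] [Ring C]
  [Algebra k A] [Algebra k B] [Algebra k C]
variable {K P M : Type} [AddCommGroup K] [Module k K] [Module (A ⊗[k] Bᵐᵒᵖ) K]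
  [IsScalarTower k (A ⊗[k] Bᵐᵒᵖ) K] [AddCommGroup P] [Module k P] [Module (A ⊗[k] Bᵐᵒᵖ) P]
  [IsScalarTower k (A ⊗[k] Bᵐᵒᵖ) P] [AddCommGroup M] [Module k M] [Module (A ⊗[k] Bᵐᵒᵖ) M]
  [IsScalarTower k (A ⊗[k] Bᵐᵒᵖ) M]
variable (Y : Type) [AddCommGroup Y] [Module k Y] [Module (B ⊗[k] Cᵐᵒᵖ) Y]
  [IsScalarTower k (B ⊗[k] Cᵐᵒᵖ) Y]

/-- If `P` is a finitely generated projective bimodule and `Y` is finitely generated projective as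
a right module, then `P ⊗_B Y` is a finitely generated projective bimodule. -/
theorem finite_and_projective [Module.Finite (A ⊗[k] Bᵐᵒᵖ) P]
    [Module.Projective (A ⊗[k] Bᵐᵒᵖ) P]
    (hYfin : letI := rightRestrict k B C Y; Module.Finite Cᵐᵒᵖ Y)
    (hYproj : letI := rightRestrict k B C Y; Module.Projective Cᵐᵒᵖ Y) :
    Module.Finite (A ⊗[k] Cᵐᵒᵖ) (BTensor k A B C P Y) ∧
      Module.Projective (A ⊗[k] Cᵐᵒᵖ) (BTensor k A B C P Y) := by
  obtain ⟨m, f, p, hp⟩ := exists_dual_basis (A ⊗[k] Bᵐᵒᵖ) P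
  obtain ⟨n, g, hg, v, hv⟩ : ∃ (n : ℕ) (g : Fin n → Y →ₗ[k] Cᵐᵒᵖ)
      (_ : ∀ i (c : Cᵐᵒᵖ) (y : Y), g i (((1 : B) ⊗ₜ[k] c) • y) = c * g i y) (v : Fin n → Y),
      ∀ y, ∑ i, ((1 : B) ⊗ₜ[k] g i y) • v i = y := by
    let := rightRestrict k B C Y
    have := isScalarTower_rightRestrict k B C Y
    obtain ⟨n, g, v, hv⟩ := exists_dual_basis Cᵐᵒᵖ Y
    exact ⟨n, fun i => (g i).restrictScalars k, fun i c y => (g i).map_smul c y, v, hv⟩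
  refine finite_and_projective_of_dual_basis (ι := Fin m × Fin n)
    (fun i => freeCoord k A B C (g i.2) (hg i.2) ∘ₗ map k C Y (f i.1))
    (fun i => mk k A B C P Y (p i.1 ⊗ₜ v i.2)) fun z => ?_
  obtain ⟨t, rfl⟩ := mk_surjective k A B C P Y z
  induction t using TensorProduct.induction_on with
  | zero =>
    rw [map_zero]
    exact Finset.sum_eq_zero fun i _ => by rw [map_zero]; exact zero_smul (A ⊗[k] Cᵐᵒᵖ) (mk k A B C P Y _)
  | add _ _ h₁ h₂ => simp only [map_add, add_smul, Finset.sum_add_distrib, h₁, h₂]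
  | tmul x y =>
    simp only [Fintype.sum_prod_type, LinearMap.comp_apply, map_mk_tmul,
      sum_freeCoord_smul k g hg v hv]
    rw [← map_sum, ← sum_tmul, hp]

/-- Tensoring a short exact sequence of bimodules whose last term is projective as a right module
yields a short exact sequence. -/
theorem map_exact_of_projective (i : K →ₗ[A ⊗[k] Bᵐᵒᵖ] P) (p : P →ₗ[A ⊗[k] Bᵐᵒᵖ] M)
    (hi : Function.Injective i) (hip : Function.Exact i p) (hp : Function.Surjective p)
    (hM : letI := rightRestrict k A B M; Module.Projective Bᵐᵒᵖ M) :
    Function.Injective (map k C Y i) ∧ Function.Exact (map k C Y i) (map k C Y p) ∧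
      Function.Surjective (map k C Y p) := by
  obtain ⟨s, hs, hps⟩ : ∃ (s : M →ₗ[k] P)
      (_ : ∀ (b : B) (x : M), s (((1 : A) ⊗ₜ[k] op b) • x) = ((1 : A) ⊗ₜ[k] op b) • s x),
      ∀ x, p (s x) = x := by
    let := rightRestrict k A B M
    let := rightRestrict k A B P
    have := isScalarTower_rightRestrict k A B M
    have := isScalarTower_rightRestrict k A B P
    let p' : P →ₗ[Bᵐᵒᵖ] M :=
      { toFun := p, map_add' := p.map_add, map_smul' := fun b x => p.map_smul _ x }
    obtain ⟨s, hs⟩ := Module.projective_lifting_property p' LinearMap.id hp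
    exact ⟨s.restrictScalars k, fun b x => s.map_smul (op b) x, fun x => LinearMap.congr_fun hs x⟩
  have hr' (x : P) : ∃ y, i y = x - s (p x) := (hip _).1 (by simp [hps])
  choose r' hr' using hr'
  have hpi (x : K) : p (i x) = 0 := hip.apply_apply_eq_zero x
  let r : P →ₗ[k] K :=
    { toFun := r'
      map_add' := fun x y => hi (by simp only [hr', map_add]; abel)
      map_smul' := fun c x => hi (by
        have h₁ : p (c • x) = c • p x := (p.restrictScalars k).map_smul c x
        have h₂ : i (c • r' x) = c • i (r' x) := (i.restrictScalars k).map_smul c _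
        simp [h₁, h₂, hr', smul_sub]) }
  have hr (x : P) : i (r x) = x - s (p x) := hr' x
  have hrB (b : B) (x : P) :
      r (((1 : A) ⊗ₜ[k] op b) • x) = ((1 : A) ⊗ₜ[k] op b) • r x :=
    hi (by simp [hr, hs, smul_sub])
  have hri (x : K) : r (i x) = x := hi (by simp [hr, hpi])
  have hri' : (mapAdd k C Y r hrB).comp (map k C Y i).toAddMonoidHom = AddMonoidHom.id _ :=
    addHom_ext k fun x y => by simp [hri]
  have hps' : (map k C Y p).toAddMonoidHom.comp (mapAdd k C Y s hs) = AddMonoidHom.id _ :=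
    addHom_ext k fun x y => by simp [hps]
  have hpi' : (map k C Y p).toAddMonoidHom.comp (map k C Y i).toAddMonoidHom = 0 :=
    addHom_ext k fun x y => by simp [hpi]
  have hsum : (map k C Y i).toAddMonoidHom.comp (mapAdd k C Y r hrB) +
      (mapAdd k C Y s hs).comp (map k C Y p).toAddMonoidHom = AddMonoidHom.id _ :=
    addHom_ext k fun x y => by simp [hr, ← map_add, ← add_tmul]
  refine ⟨Function.LeftInverse.injective (DFunLike.congr_fun hri'), fun z => ⟨fun hz => ?_, ?_⟩,
    Function.RightInverse.surjective (DFunLike.congr_fun hps')⟩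
  · have h := DFunLike.congr_fun hsum z
    simp only [AddMonoidHom.add_apply, AddMonoidHom.comp_apply, LinearMap.toAddMonoidHom_coe, hz,
      map_zero, add_zero] at h
    exact ⟨_, h⟩
  · rintro ⟨y, rfl⟩
    exact DFunLike.congr_fun hpi' y

end BTensor

/-- `Ω_{Λᵉ}(M ⊗_Γ N)` is stably isomorphic to `Ω_{Λ⊗Γᵒᵖ}(M) ⊗_Γ N`. -/
theorem statement_11 (k Λ Γ : Type) [Field k] [Ring Λ] [Ring Γ]
    [Algebra k Λ] [Algebra k Γ] [FiniteDimensional k Λ] [FiniteDimensional k Γ]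
    (M : Type) [AddCommGroup M] [Module k M] [Module (Λ ⊗[k] Γᵐᵒᵖ) M]
    [IsScalarTower k (Λ ⊗[k] Γᵐᵒᵖ) M]
    (hMfg : Module.Finite (Λ ⊗[k] Γᵐᵒᵖ) M)
    (hMproj : letI := rightRestrict k Λ Γ M; Module.Projective Γᵐᵒᵖ M)
    (N : Type) [AddCommGroup N] [Module k N] [Module (Γ ⊗[k] Λᵐᵒᵖ) N]
    [IsScalarTower k (Γ ⊗[k] Λᵐᵒᵖ) N]
    (hNfg : Module.Finite (Γ ⊗[k] Λᵐᵒᵖ) N)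
    (hNproj : letI := rightRestrict k Γ Λ N; Module.Projective Λᵐᵒᵖ N)
    (SM : ModuleCat.{0} (Λ ⊗[k] Γᵐᵒᵖ))
    (hSM : IsSyzygyOf (Λ ⊗[k] Γᵐᵒᵖ) SM (ModuleCat.of (Λ ⊗[k] Γᵐᵒᵖ) M))
    (W : ModuleCat.{0} (Λ ⊗[k] Λᵐᵒᵖ))
    (hW : IsSyzygyOf (Λ ⊗[k] Λᵐᵒᵖ) W
      (ModuleCat.of (Λ ⊗[k] Λᵐᵒᵖ) (BTensor k Λ Γ Λ M N))) :
    letI : Module k SM := modK k (Λ ⊗[k] Γᵐᵒᵖ) SM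
    letI : IsScalarTower k (Λ ⊗[k] Γᵐᵒᵖ) SM := towerK k (Λ ⊗[k] Γᵐᵒᵖ) SM
    StablyIso (Λ ⊗[k] Λᵐᵒᵖ) W (BTensor k Λ Γ Λ SM N) := by
  let : Module k SM := modK k (Λ ⊗[k] Γᵐᵒᵖ) SM
  have : IsScalarTower k (Λ ⊗[k] Γᵐᵒᵖ) SM := towerK k (Λ ⊗[k] Γᵐᵒᵖ) SM
  obtain ⟨P, p, ⟨_, _, hp, -⟩, ⟨e⟩⟩ := hSM
  obtain ⟨Q, q, ⟨hQfin, hQproj, hq, -⟩, ⟨e'⟩⟩ := hW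
  let : Module k P := modK k (Λ ⊗[k] Γᵐᵒᵖ) P
  have : IsScalarTower k (Λ ⊗[k] Γᵐᵒᵖ) P := towerK k (Λ ⊗[k] Γᵐᵒᵖ) P
  have hNfin : letI := rightRestrict k Γ Λ N; Module.Finite Λᵐᵒᵖ N := by
    let := rightRestrict k Γ Λ N
    have := isScalarTower_rightRestrict k Γ Λ N
    have : Module.Finite k N := Module.Finite.trans (Γ ⊗[k] Λᵐᵒᵖ) N
    exact Module.Finite.of_restrictScalars_finite k Λᵐᵒᵖ N
  obtain ⟨hPfin, hPproj⟩ := BTensor.finite_and_projective (A := Λ) (P := P) N hNfin hNproj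
  let p' : P →ₗ[Λ ⊗[k] Γᵐᵒᵖ] M := p
  let i : SM →ₗ[Λ ⊗[k] Γᵐᵒᵖ] P := (LinearMap.ker p).subtype ∘ₗ e.toLinearMap
  have hip : Function.Exact i p' := by
    rw [LinearMap.exact_iff, LinearMap.range_comp, LinearEquiv.range, Submodule.map_top,
      Submodule.range_subtype]
  obtain ⟨hi, hip', hp'⟩ := BTensor.map_exact_of_projective (C := Λ) N i p'
    ((LinearMap.ker p).injective_subtype.comp e.injective) hip hp hMproj
  obtain ⟨φ⟩ := nonempty_ker_prod_equiv_ker_prod q (BTensor.map k Λ N p') hq hp'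
  let e'' := LinearEquiv.ofInjective _ hi ≪≫ₗ LinearEquiv.ofEq _ _ hip'.linearMap_ker_eq.symm
  exact ⟨ModuleCat.of _ (BTensor k Λ Γ Λ P N), Q, hPfin, hPproj, hQfin, hQproj,
    ⟨e'.prodCongr (.refl _ _) ≪≫ₗ φ ≪≫ₗ e''.symm.prodCongr (.refl _ _)⟩⟩
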